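/- arXiv:1802.02352 — 2 statements merged into one kernel-verified Lean document; each statement's English description precedes it below -/
import Mathlib

section
/- Let s ∈ 𝔛 with all s_k > 0 and let R*_s be the Riesz measure with Laplace transform Δ_{−s} on 𝒫; let s′ ∈ Ξ with all s′_k > 0 and let R_{s′} be the Riesz measure with Laplace transform δ_{−s′} on 𝒬. Then for every T ∈ H: V_{F(R*_s)}(ρ*(T)I_N) = ρ*(T) ∘ V_{F(R*_s)}(I_N) ∘ ρ(T), and V_{F(R_{s′})}(ρ(T)I_N) = ρ(T) ∘ V_{F(R_{s′})}(I_N) ∘ ρ*(T), where V_{F(μ)} denotes the variance function of the natural exponential family F(μ), viewed as a linear operator on 𝒵. -/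
open Matrix MeasureTheory Finset
open scoped ENNReal

namespace Wishart

instance {m n α : Type*} [MeasurableSpace α] : MeasurableSpace (Matrix m n α) :=
  inferInstanceAs (MeasurableSpace (m → n → α))

/-- Index set of an `N × N` matrix partitioned into `r + 1` blocks of sizes `n 0, …, n r`. -/
abbrev Idx (r : ℕ) (n : Fin (r + 1) → ℕ+) := Σ k : Fin (r + 1), Fin (n k)

/-- Real matrices over the partitioned index set. -/
abbrev Mat (r : ℕ) (n : Fin (r + 1) → ℕ+) := Matrix (Idx r n) (Idx r n) ℝ

variable {r : ℕ} {n : Fin (r + 1) → ℕ+}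

/-- The `(l,k)` block of a partitioned matrix. -/
def blk (x : Mat r n) (l k : Fin (r + 1)) : Matrix (Fin (n l)) (Fin (n k)) ℝ :=
  Matrix.of fun a b => x ⟨l, a⟩ ⟨k, b⟩

variable (V : ∀ l k : Fin (r + 1), Submodule ℝ (Matrix (Fin (n l)) (Fin (n k)) ℝ))

/-- Condition (V1): `A ∈ 𝒱_{lk}`, `B ∈ 𝒱_{ki}` implies `A B ∈ 𝒱_{li}` for `i < k < l`. -/
def CondV1 : Prop := ∀ i k l : Fin (r + 1), i < k → k < l →
  ∀ A ∈ V l k, ∀ B ∈ V k i, A * B ∈ V l i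

/-- Condition (V2): `A ∈ 𝒱_{li}`, `B ∈ 𝒱_{ki}` implies `A Bᵀ ∈ 𝒱_{lk}` for `i < k < l`. -/
def CondV2 : Prop := ∀ i k l : Fin (r + 1), i < k → k < l →
  ∀ A ∈ V l i, ∀ B ∈ V k i, A * Bᵀ ∈ V l k

/-- Condition (V3): `A ∈ 𝒱_{lk}` implies `A Aᵀ ∈ ℝ I`. -/
def CondV3 : Prop := ∀ k l : Fin (r + 1), k < l →
  ∀ A ∈ V l k, ∃ c : ℝ, A * Aᵀ = c • (1 : Matrix (Fin (n l)) (Fin (n l)) ℝ)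

/-- The space `𝒵` of symmetric matrices with lower blocks in `𝒱_{lk}` and scalar diagonal
blocks. -/
def Zspace : Set (Mat r n) :=
  {x | x.IsSymm ∧ (∀ k l : Fin (r + 1), k < l → blk x l k ∈ V l k) ∧
    ∀ k : Fin (r + 1), ∃ c : ℝ, ∀ a b : Fin (n k),
      x ⟨k, a⟩ ⟨k, b⟩ = if a = b then c else 0}

/-- The trace inner product `⟨x, y⟩ = tr (x y)`. -/
def tip (x y : Mat r n) : ℝ := (x * y).trace

/-- The homogeneous cone `𝒫 = 𝒵 ∩ Sym₊(N, ℝ)`. -/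
def Pcone : Set (Mat r n) := {x | x ∈ Zspace V ∧ x.PosDef}

/-- The dual cone `𝒬 = {ξ ∈ 𝒵 : ⟨ξ, x⟩ > 0 for all nonzero x in the closure of 𝒫}`. -/
def Qcone : Set (Mat r n) :=
  {ξ | ξ ∈ Zspace V ∧ ∀ x ∈ closure (Pcone V), x ≠ 0 → 0 < tip ξ x}

/-- The group `H` of block lower triangular matrices with strictly lower blocks in `𝒱_{lk}`
and positive scalar diagonal blocks. -/
def Hgrp : Set (Mat r n) :=
  {T | (∀ k l : Fin (r + 1), l < k → blk T l k = 0) ∧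
    (∀ k l : Fin (r + 1), k < l → blk T l k ∈ V l k) ∧
    ∀ k : Fin (r + 1), ∃ t : ℝ, 0 < t ∧ ∀ a b : Fin (n k),
      T ⟨k, a⟩ ⟨k, b⟩ = if a = b then t else 0}

/-- `ρ(T) x = T x Tᵀ`. -/
def rhoM (T x : Mat r n) : Mat r n := T * x * Tᵀ

/-- The diagonal scalar `t_{kk}` of a matrix with scalar diagonal blocks. -/
def tdiag (T : Mat r n) (k : Fin (r + 1)) : ℝ :=
  T ⟨k, ⟨0, (n k).2⟩⟩ ⟨k, ⟨0, (n k).2⟩⟩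

/-- The one-dimensional representation `χ_s(T) = ∏_k t_{kk}^{2 s_k}`. -/
noncomputable def chi (s : Fin (r + 1) → ℝ) (T : Mat r n) : ℝ :=
  ∏ k : Fin (r + 1), tdiag T k ^ (2 * s k)

/-- `½ Σ_{i<k} ε_i dim 𝒱_{ki}`. -/
noncomputable def xiBound (ε : Fin (r + 1) → Bool) (k : Fin (r + 1)) : ℝ :=
  (1 / 2) * ∑ i ∈ Finset.univ.filter (fun i => i < k),
    (if ε i then (Module.finrank ℝ (V k i) : ℝ) else 0)

/-- The Gindikin set `Ξ`. -/
def XiSet : Set (Fin (r + 1) → ℝ) :=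
  ⋃ ε : Fin (r + 1) → Bool,
    {s | ∀ k, (ε k = true → xiBound V ε k < s k) ∧ (ε k = false → s k = xiBound V ε k)}

/-- `½ Σ_{l>k} ε_l dim 𝒱_{lk}`. -/
noncomputable def frakBound (ε : Fin (r + 1) → Bool) (k : Fin (r + 1)) : ℝ :=
  (1 / 2) * ∑ l ∈ Finset.univ.filter (fun l => k < l),
    (if ε l then (Module.finrank ℝ (V l k) : ℝ) else 0)

/-- The Gindikin set `𝔛`. -/
def frakX : Set (Fin (r + 1) → ℝ) :=
  ⋃ ε : Fin (r + 1) → Bool,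
    {s | ∀ k, (ε k = true → frakBound V ε k < s k) ∧ (ε k = false → s k = frakBound V ε k)}

/-- Laplace transform `L_μ(θ) = ∫ e^{-⟨θ,x⟩} dμ(x)` (with values in `[0,∞]`). -/
noncomputable def laplace (μ : Measure (Mat r n)) (θ : Mat r n) : ℝ≥0∞ :=
  ∫⁻ x, ENNReal.ofReal (Real.exp (-(tip θ x))) ∂μ

/-- Real-valued Laplace transform. -/
noncomputable def laplaceR (μ : Measure (Mat r n)) (θ : Mat r n) : ℝ :=
  ∫ x, Real.exp (-(tip θ x)) ∂μ

/-- Mean of the natural-exponential-family member `P(θ,μ)`, computed entrywise: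
`m_μ(θ) = L_μ(θ)⁻¹ ∫ x e^{-⟨θ,x⟩} dμ(x)`. -/
noncomputable def meanMap (μ : Measure (Mat r n)) (θ : Mat r n) : Mat r n :=
  Matrix.of fun p q => (laplaceR μ θ)⁻¹ * ∫ x, Real.exp (-(tip θ x)) * x p q ∂μ

/-- Covariance operator of `P(θ,μ)` with mean `m`, applied to `ξ ∈ 𝒵` (entrywise):
`V ξ = ∫ ⟨ξ, x - m⟩ (x - m) dP(θ,μ)(x)`. -/
noncomputable def varOp (μ : Measure (Mat r n)) (θ m ξ : Mat r n) : Mat r n :=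
  Matrix.of fun p q =>
    (laplaceR μ θ)⁻¹ * ∫ x, Real.exp (-(tip θ x)) * tip ξ (x - m) * ((x - m) p q) ∂μ

/-- Leading principal submatrix `y_{{1:k}}` consisting of the blocks with indices `≤ k`. -/
def lead (k : Fin (r + 1)) (y : Mat r n) :
    Matrix {p : Idx r n // p.1 ≤ k} {p : Idx r n // p.1 ≤ k} ℝ :=
  Matrix.of fun p q => y p.1 q.1

/-- Zero-padding `z₀` of a matrix `z` defined on the blocks with indices `≤ k`. -/
def pad (k : Fin (r + 1)) (z : Matrix {p : Idx r n // p.1 ≤ k} {p : Idx r n // p.1 ≤ k} ℝ) :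
    Mat r n :=
  Matrix.of fun p q => if h : p.1 ≤ k ∧ q.1 ≤ k then z ⟨p, h.1⟩ ⟨q, h.2⟩ else 0

/-- `J_k = (I_{N_k})₀`. -/
def Jmat (k : Fin (r + 1)) : Mat r n := pad k 1

/-- Parameters of elements of `W_i`: the scalar `x_{ii}` and the blocks `X_{li}`. -/
abbrev Wparam (r : ℕ) (n : Fin (r + 1) → ℕ+) (i : Fin (r + 1)) :=
  ℝ × ∀ l : Fin (r + 1), Matrix (Fin (n l)) (Fin (n i)) ℝ

/-- The `N × n_i` matrix in `W_i` with `i`-th block row `x_{ii} I` and `l`-th block row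
`X_{li}` for `l > i`. -/
def toW (i : Fin (r + 1)) (p : Wparam r n i) : Matrix (Idx r n) (Fin (n i)) ℝ :=
  Matrix.of fun q b =>
    if q.1 = i then (if (q.2 : ℕ) = (b : ℕ) then p.1 else 0)
    else if i < q.1 then p.2 q.1 q.2 b else 0

/-- A parameter tuple gives an honest element of `W_i`: blocks lie in `𝒱_{li}` and vanish
for `l ≤ i`. -/
def WGood (i : Fin (r + 1)) (p : Wparam r n i) : Prop :=
  (∀ l : Fin (r + 1), i < l → p.2 l ∈ V l i) ∧ (∀ l : Fin (r + 1), ¬ i < l → p.2 l = 0)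

/-- The inner product `(A|B)` on `𝒱_{lk}`, characterized by `(ABᵀ + BAᵀ)/2 = (A|B) I`. -/
noncomputable def bip (l : Fin (r + 1)) {k : Fin (r + 1)}
    (A B : Matrix (Fin (n l)) (Fin (n k)) ℝ) : ℝ :=
  (A * Bᵀ).trace / (n l : ℝ)

open scoped Classical in
/-- The generalized power function `Δ_s` on `𝒫`, defined by `Δ_s(ρ(T) I) = χ_s(T)`. -/
noncomputable def DeltaDef (s : Fin (r + 1) → ℝ) (x : Mat r n) : ℝ :=
  if h : ∃ T, T ∈ Hgrp V ∧ x = rhoM T 1 then chi s h.choose else 0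

/-- Index set for the block diagonal matrix `Φ(ξ) = diag(φ_0(ξ), …, φ_r(ξ))`,
where `φ_i(ξ)` is of size `m_i = mdc i + 1`. -/
abbrev DIdx (r : ℕ) (mdc : Fin (r + 1) → ℕ) := Σ i : Fin (r + 1), Fin (mdc i + 1)

/-- The block diagonal matrix `Φ(ξ) = diag(φ_0(ξ), …, φ_r(ξ))`. -/
def PhiMat {mdc : Fin (r + 1) → ℕ}
    (φ : ∀ i : Fin (r + 1), Mat r n → Matrix (Fin (mdc i + 1)) (Fin (mdc i + 1)) ℝ)
    (ξ : Mat r n) : Matrix (DIdx r mdc) (DIdx r mdc) ℝ :=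
  Matrix.of fun p q =>
    if h : p.1 = q.1 then φ p.1 ξ p.2 (Fin.cast (by rw [h]) q.2) else 0

/-- `Φ(I_N)^{-1/2}`: the inverse square root of the (diagonal, positive) matrix `Φ(I_N)`. -/
noncomputable def PhiISqrtInv {mdc : Fin (r + 1) → ℕ}
    (φ : ∀ i : Fin (r + 1), Mat r n → Matrix (Fin (mdc i + 1)) (Fin (mdc i + 1)) ℝ) :
    Matrix (DIdx r mdc) (DIdx r mdc) ℝ :=
  Matrix.diagonal fun p => (PhiMat φ (1 : Mat r n) p p) ^ (-(1 / 2) : ℝ)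

section

open ProbabilityTheory Filter Topology

theorem eqOn_complexMGF_of_mgf_eventuallyEq {Ω Ω' : Type*} [MeasurableSpace Ω]
    [MeasurableSpace Ω'] {X : Ω → ℝ} {Y : Ω' → ℝ} {μ : Measure Ω} {ν : Measure Ω'}
    (hX : ∀ᶠ t in 𝓝 (0 : ℝ), Integrable (fun ω => Real.exp (t * X ω)) μ)
    (hY : ∀ᶠ t in 𝓝 (0 : ℝ), Integrable (fun ω => Real.exp (t * Y ω)) ν)
    (hXY : mgf X μ =ᶠ[𝓝 0] mgf Y ν) (u : ℝ) :
    complexMGF X μ (u * Complex.I) = complexMGF Y ν (u * Complex.I) := by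
  have hX0 : (0 : ℝ) ∈ interior (integrableExpSet X μ) := mem_interior_iff_mem_nhds.2 hX
  have hY0 : (0 : ℝ) ∈ interior (integrableExpSet Y ν) := mem_interior_iff_mem_nhds.2 hY
  let S : Set ℂ := Complex.reCLM ⁻¹'
    (interior (integrableExpSet X μ) ∩ interior (integrableExpSet Y ν))
  have hS : Convex ℝ S :=
    (convex_integrableExpSet.interior.inter convex_integrableExpSet.interior).linear_preimage
      Complex.reCLM.toLinearMap
  have heq : Set.EqOn (complexMGF X μ) (complexMGF Y ν) S := by
    refine AnalyticOnNhd.eqOn_of_preconnected_of_frequently_eq (z₀ := 0)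
      (analyticOnNhd_complexMGF.mono fun z hz => hz.1)
      (analyticOnNhd_complexMGF.mono fun z hz => hz.2) hS.isPreconnected
      (by simpa [S] using ⟨hX0, hY0⟩) ?_
    have h0 : Tendsto (fun t : ℝ => (t : ℂ)) (𝓝[≠] 0) (𝓝[≠] 0) := by
      refine tendsto_nhdsWithin_of_tendsto_nhds_of_eventually_within _ ?_ ?_
      · simpa using (Complex.continuous_ofReal.tendsto 0).mono_left nhdsWithin_le_nhds
      · filter_upwards [self_mem_nhdsWithin] with t ht using by simpa using ht
    refine h0.frequently (Eventually.frequently ?_)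
    filter_upwards [nhdsWithin_le_nhds hXY] with t ht
    simp only [complexMGF_ofReal, ht]
  exact heq (by simpa [S] using ⟨hX0, hY0⟩)

/-- Two finite measures whose one-dimensional moment generating functions are finite and agree
near the origin are equal. -/
theorem measure_ext_of_mgf_eventuallyEq {E : Type*} [NormedAddCommGroup E] [NormedSpace ℝ E]
    [CompleteSpace E] [SecondCountableTopology E] [MeasurableSpace E] [BorelSpace E]
    {μ ν : Measure E} [IsFiniteMeasure μ] [IsFiniteMeasure ν]
    (hμ : ∀ ℓ : StrongDual ℝ E, ∀ᶠ t in 𝓝 (0 : ℝ), Integrable (fun x => Real.exp (t * ℓ x)) μ)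
    (hν : ∀ ℓ : StrongDual ℝ E, ∀ᶠ t in 𝓝 (0 : ℝ), Integrable (fun x => Real.exp (t * ℓ x)) ν)
    (h : ∀ ℓ : StrongDual ℝ E, mgf ℓ μ =ᶠ[𝓝 0] mgf ℓ ν) : μ = ν := by
  refine Measure.ext_of_charFunDual (funext fun ℓ => ?_)
  rw [charFunDual_eq_charFun_map_one, charFunDual_eq_charFun_map_one,
    ← complexMGF_mul_I (by fun_prop), ← complexMGF_mul_I (by fun_prop)]
  exact eqOn_complexMGF_of_mgf_eventuallyEq (hμ ℓ) (hν ℓ) (h ℓ) 1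

instance : BorelSpace (Mat r n) :=
  inferInstanceAs (BorelSpace (Idx r n → Idx r n → ℝ))

section tip

theorem tip_comm (x y : Mat r n) : tip x y = tip y x := Matrix.trace_mul_comm x y

/-- The trace pairing as a linear functional of its second argument. -/
def tipₗ (x : Mat r n) : Mat r n →ₗ[ℝ] ℝ :=
  (Matrix.traceLinearMap (Idx r n) ℝ ℝ).comp (LinearMap.mulLeft ℝ x)

@[simp] theorem tipₗ_apply (x y : Mat r n) : tipₗ x y = tip x y := rfl

theorem tip_add_left (x y z : Mat r n) : tip (x + y) z = tip x z + tip y z := by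
  simp [tip, add_mul]

theorem tip_sub_left (x y z : Mat r n) : tip (x - y) z = tip x z - tip y z := by
  simp [tip, sub_mul]

theorem tip_smul_left (c : ℝ) (x y : Mat r n) : tip (c • x) y = c * tip x y := by
  simp [tip]

theorem tip_sub_right (x y z : Mat r n) : tip x (y - z) = tip x y - tip x z := by
  simp [tip, mul_sub]

@[fun_prop]
theorem continuous_tip (x : Mat r n) : Continuous (tip x) :=
  (continuous_const.matrix_mul continuous_id).matrix_trace

theorem tip_self_eq_zero {x : Mat r n} (hx : x.IsSymm) : tip x x = 0 ↔ x = 0 := by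
  have := Matrix.trace_conjTranspose_mul_self_eq_zero_iff (A := x)
  rwa [Matrix.conjTranspose_eq_transpose_of_trivial, hx.eq] at this

theorem linear_eq_sum (ℓ : Mat r n →ₗ[ℝ] ℝ) (x : Mat r n) :
    ℓ x = ∑ p, ∑ q, x p q * ℓ (Matrix.single p q 1) := by
  conv_lhs => rw [Matrix.matrix_eq_sum_single x]
  simp only [map_sum]
  refine Finset.sum_congr rfl fun p _ => Finset.sum_congr rfl fun q _ => ?_
  conv_lhs => rw [← mul_one (x p q), ← smul_eq_mul (x p q), ← Matrix.smul_single, map_smul]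
  simp

theorem linear_eq_tip (ℓ : Mat r n →ₗ[ℝ] ℝ) (x : Mat r n) :
    ℓ x = tip (Matrix.of fun q p => ℓ (Matrix.single p q 1)) x := by
  rw [linear_eq_sum, Finset.sum_comm]
  simp [tip, Matrix.trace, Matrix.mul_apply, mul_comm]

variable {Z : Submodule ℝ (Mat r n)}

theorem eq_of_tip_eq (hZ : ∀ x ∈ Z, x.IsSymm) {x y : Mat r n} (hx : x ∈ Z) (hy : y ∈ Z)
    (h : ∀ z ∈ Z, tip x z = tip y z) : x = y := by
  have hd := Z.sub_mem hx hy
  rw [← sub_eq_zero, ← tip_self_eq_zero (hZ _ hd), tip_sub_left, h _ hd, sub_self]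

/-- Orthogonal projection onto a space of symmetric matrices for the trace pairing. -/
theorem exists_tip_projection (hZ : ∀ x ∈ Z, x.IsSymm) :
    ∃ π : Mat r n →ₗ[ℝ] Mat r n, (∀ y, π y ∈ Z) ∧ ∀ y, ∀ x ∈ Z, tip (π y) x = tip y x := by
  let f : Mat r n →ₗ[ℝ] Module.Dual ℝ Z :=
    { toFun := fun y => (tipₗ y).comp Z.subtype
      map_add' := fun x y => by ext z; simp [tip_add_left]
      map_smul' := fun c x => by ext z; simp [tip_smul_left] }
  have hinj : Function.Injective (f.comp Z.subtype) := fun x y h =>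
    Subtype.ext (eq_of_tip_eq hZ x.2 y.2 fun z hz => LinearMap.congr_fun h ⟨z, hz⟩)
  let e := LinearEquiv.ofInjectiveOfFinrankEq (f.comp Z.subtype) hinj
    Subspace.dual_finrank_eq.symm
  refine ⟨Z.subtype.comp (e.symm.toLinearMap.comp f), fun y => (e.symm (f y)).2, fun y x hx => ?_⟩
  exact LinearMap.congr_fun (e.apply_symm_apply (f y)) ⟨x, hx⟩

theorem exists_mem_eq_tip (hZ : ∀ x ∈ Z, x.IsSymm) (ℓ : Mat r n →ₗ[ℝ] ℝ) :
    ∃ ξ ∈ Z, ∀ x ∈ Z, ℓ x = tip ξ x := by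
  obtain ⟨π, hπ, h⟩ := exists_tip_projection hZ
  exact ⟨_, hπ _, fun x hx => by rw [h _ x hx, ← linear_eq_tip]⟩

end tip

section laplace

variable {Z : Submodule ℝ (Mat r n)} {μ ν : Measure (Mat r n)}

theorem ae_mem_of_compl (hμ : μ (Z : Set (Mat r n))ᶜ = 0) : ∀ᵐ x ∂μ, x ∈ Z := hμ

theorem integrable_exp_iff (θ : Mat r n) :
    Integrable (fun x => Real.exp (-(tip θ x))) μ ↔ laplace μ θ ≠ ∞ := by
  rw [← lt_top_iff_ne_top, laplace, ← hasFiniteIntegral_iff_ofReal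
    (Eventually.of_forall fun x => (Real.exp_pos _).le)]
  exact ⟨fun h => h.2, fun h => ⟨by fun_prop, h⟩⟩

attribute [local instance] Matrix.normedAddCommGroup Matrix.normedSpace

theorem measure_ext_of_laplace (hZ : ∀ x ∈ Z, x.IsSymm)
    (hμ : μ (Z : Set (Mat r n))ᶜ = 0) (hν : ν (Z : Set (Mat r n))ᶜ = 0)
    (hfin : ∀ ξ ∈ Z, ∀ᶠ t in 𝓝 (0 : ℝ), laplace μ (1 + t • ξ) ≠ ∞)
    (h : ∀ ξ ∈ Z, ∀ᶠ t in 𝓝 (0 : ℝ), laplace μ (1 + t • ξ) = laplace ν (1 + t • ξ)) :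
    μ = ν := by
  let w : Mat r n → ℝ≥0∞ := fun x => ENNReal.ofReal (Real.exp (-(tip 1 x)))
  have hw : Measurable w := by fun_prop
  have hinv : ∀ μ : Measure (Mat r n), (μ.withDensity w).withDensity w⁻¹ = μ := fun μ =>
    withDensity_inv_same hw (Eventually.of_forall fun x => by simp [w, Real.exp_pos])
      (Eventually.of_forall fun x => ENNReal.ofReal_ne_top)
  have hfinite : ∀ μ : Measure (Mat r n), laplace μ 1 ≠ ∞ →
      IsFiniteMeasure (μ.withDensity w) := fun μ h => isFiniteMeasure_withDensity h
  have h1 : laplace μ 1 ≠ ∞ := by simpa using (hfin 0 Z.zero_mem).self_of_nhds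
  have h2 : laplace ν 1 ≠ ∞ := by
    have := (h 0 Z.zero_mem).self_of_nhds
    rw [zero_smul, add_zero] at this
    rwa [← this]
  have := hfinite μ h1
  have := hfinite ν h2
  have key : ∀ μ : Measure (Mat r n), μ (Z : Set (Mat r n))ᶜ = 0 → ∀ (ℓ : Mat r n → ℝ) (ξ),
      Measurable ℓ → (∀ x ∈ Z, ℓ x = tip ξ x) → ∀ t : ℝ,
      ∫⁻ x, ENNReal.ofReal (Real.exp (t * ℓ x)) ∂(μ.withDensity w)
        = laplace μ (1 + t • (-ξ)) := by
    intro μ hμ ℓ ξ hℓ hξ t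
    rw [lintegral_withDensity_eq_lintegral_mul _ hw (by fun_prop)]
    refine lintegral_congr_ae ?_
    filter_upwards [ae_mem_of_compl hμ] with x hx
    simp only [w, Pi.mul_apply]
    rw [← ENNReal.ofReal_mul (Real.exp_pos _).le, ← Real.exp_add, hξ x hx, smul_neg,
      ← neg_smul, tip_add_left, tip_smul_left]
    ring_nf
  have hInt : ∀ μ : Measure (Mat r n), μ (Z : Set (Mat r n))ᶜ = 0 →
      (∀ ξ ∈ Z, ∀ᶠ t in 𝓝 (0 : ℝ), laplace μ (1 + t • ξ) ≠ ∞) → ∀ ℓ : StrongDual ℝ (Mat r n),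
      ∀ᶠ t in 𝓝 (0 : ℝ), Integrable (fun x => Real.exp (t * ℓ x)) (μ.withDensity w) := by
    intro μ hμ hfin ℓ
    obtain ⟨ξ, hξ, hℓ⟩ := exists_mem_eq_tip hZ ℓ.toLinearMap
    filter_upwards [hfin _ (Z.neg_mem hξ)] with t ht
    refine ⟨by fun_prop, ?_⟩
    rw [hasFiniteIntegral_iff_ofReal (Eventually.of_forall fun x => (Real.exp_pos _).le),
      key μ hμ ℓ ξ (by fun_prop) hℓ]
    exact ht.lt_top
  have hborel : @BorelSpace (Mat r n) PseudoMetricSpace.toUniformSpace.toTopologicalSpace _ :=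
    inferInstanceAs (BorelSpace (Idx r n → Idx r n → ℝ))
  have heq : μ.withDensity w = ν.withDensity w := by
    refine measure_ext_of_mgf_eventuallyEq (hInt μ hμ hfin) (hInt ν hν fun ξ hξ => ?_)
      fun ℓ => ?_
    · filter_upwards [hfin ξ hξ, h ξ hξ] with t h1 h2 using h2 ▸ h1
    · obtain ⟨ξ, hξ, hℓ⟩ := exists_mem_eq_tip hZ ℓ.toLinearMap
      filter_upwards [h _ (Z.neg_mem hξ)] with t ht
      rw [mgf, mgf, integral_eq_lintegral_of_nonneg_ae
        (Eventually.of_forall fun x => (Real.exp_pos _).le) (by fun_prop),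
        integral_eq_lintegral_of_nonneg_ae
        (Eventually.of_forall fun x => (Real.exp_pos _).le) (by fun_prop),
        key μ hμ ℓ ξ (by fun_prop) hℓ, key ν hν ℓ ξ (by fun_prop) hℓ, ht]
  rw [← hinv μ, heq, hinv]

end laplace

section moments

variable {Z : Submodule ℝ (Mat r n)} {μ : Measure (Mat r n)} {C : Set (Mat r n)}

/-- Openness of `C` along every line with direction in `Z`. -/
def LineOpen (Z : Submodule ℝ (Mat r n)) (C : Set (Mat r n)) : Prop :=
  ∀ θ ∈ C, ∀ ξ ∈ Z, ∀ᶠ t in 𝓝 (0 : ℝ), θ + t • ξ ∈ C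

theorem integrable_exp_mul_tip_sq (hC : LineOpen Z C)
    (hfin : ∀ θ ∈ C, Integrable (fun x => Real.exp (-(tip θ x))) μ)
    {θ ξ : Mat r n} (hθ : θ ∈ C) (hξ : ξ ∈ Z) :
    Integrable (fun x => Real.exp (-(tip θ x)) * tip ξ x ^ 2) μ := by
  obtain ⟨t, ⟨h1, h2⟩, ht⟩ := (((hC θ hθ ξ hξ).and (hC θ hθ (-ξ) (Z.neg_mem hξ))).filter_mono
    nhdsWithin_le_nhds |>.and (self_mem_nhdsWithin (s := Set.Ioi (0 : ℝ)))).exists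
  refine (((hfin _ h1).add (hfin _ h2)).const_mul (2 / t ^ 2)).mono' (by fun_prop) ?_
  refine Eventually.of_forall fun x => ?_
  have hsq : ∀ u : ℝ, u ^ 2 ≤ 2 * (Real.exp (-u) + Real.exp u) := by
    intro u
    have := Real.quadratic_le_exp_of_nonneg (abs_nonneg u)
    have h3 : Real.exp |u| ≤ Real.exp (-u) + Real.exp u := by
      rcases abs_cases u with ⟨h, _⟩ | ⟨h, _⟩ <;> rw [h]
      · linarith [Real.exp_pos (-u)]
      · linarith [Real.exp_pos u]
    nlinarith [sq_abs u, abs_nonneg u]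
  rw [Real.norm_of_nonneg (by positivity), Pi.add_apply, smul_neg, ← neg_smul, tip_add_left,
    tip_add_left, tip_smul_left, tip_smul_left, neg_add, neg_add, Real.exp_add, Real.exp_add,
    ← mul_add, neg_mul, neg_neg, div_mul_eq_mul_div, le_div_iff₀ (by positivity)]
  have := mul_le_mul_of_nonneg_left (hsq (t * tip ξ x)) (Real.exp_pos (-tip θ x)).le
  linarith

theorem integrable_exp_mul_tip_mul_tip (hC : LineOpen Z C)
    (hfin : ∀ θ ∈ C, Integrable (fun x => Real.exp (-(tip θ x))) μ)
    {θ ξ η : Mat r n} (hθ : θ ∈ C) (hξ : ξ ∈ Z) (hη : η ∈ Z) :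
    Integrable (fun x => Real.exp (-(tip θ x)) * (tip ξ x * tip η x)) μ := by
  refine ((integrable_exp_mul_tip_sq hC hfin hθ hξ).add
    (integrable_exp_mul_tip_sq hC hfin hθ hη)).mono' (by fun_prop) ?_
  refine Eventually.of_forall fun x => ?_
  rw [Pi.add_apply, ← mul_add, norm_mul, Real.norm_of_nonneg (Real.exp_pos _).le]
  refine mul_le_mul_of_nonneg_left ?_ (Real.exp_pos _).le
  rw [Real.norm_eq_abs, abs_le]
  constructor <;> nlinarith [sq_nonneg (tip ξ x + tip η x), sq_nonneg (tip ξ x - tip η x),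
    sq_nonneg (tip ξ x), sq_nonneg (tip η x)]

theorem integrable_exp_mul_tip (hC : LineOpen Z C)
    (hfin : ∀ θ ∈ C, Integrable (fun x => Real.exp (-(tip θ x))) μ)
    {θ ξ : Mat r n} (hθ : θ ∈ C) (hξ : ξ ∈ Z) :
    Integrable (fun x => Real.exp (-(tip θ x)) * tip ξ x) μ := by
  refine ((hfin θ hθ).add (integrable_exp_mul_tip_sq hC hfin hθ hξ)).mono' (by fun_prop) ?_
  refine Eventually.of_forall fun x => ?_
  rw [Pi.add_apply, ← mul_one_add, norm_mul, Real.norm_of_nonneg (Real.exp_pos _).le]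
  refine mul_le_mul_of_nonneg_left ?_ (Real.exp_pos _).le
  rw [Real.norm_eq_abs, abs_le]
  constructor <;> nlinarith [sq_nonneg (tip ξ x + 1), sq_nonneg (tip ξ x - 1)]

/-- Entrywise integral of a matrix-valued function. -/
noncomputable def entryInt (μ : Measure (Mat r n)) (g : Mat r n → Mat r n) : Mat r n :=
  Matrix.of fun p q => ∫ x, g x p q ∂μ

theorem linear_entryInt {g : Mat r n → Mat r n} (hg : ∀ p q, Integrable (fun x => g x p q) μ)
    (ℓ : Mat r n →ₗ[ℝ] ℝ) : ℓ (entryInt μ g) = ∫ x, ℓ (g x) ∂μ := by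
  rw [linear_eq_sum ℓ, integral_congr_ae (Eventually.of_forall fun x => linear_eq_sum ℓ (g x))]
  rw [integral_finsetSum _ fun p _ => integrable_finsetSum _ fun q _ => (hg p q).mul_const _]
  refine Finset.sum_congr rfl fun p _ => ?_
  rw [integral_finsetSum _ fun q _ => (hg p q).mul_const _]
  exact Finset.sum_congr rfl fun q _ => (integral_mul_const _ _).symm

theorem map_entryInt {g : Mat r n → Mat r n} (hg : ∀ p q, Integrable (fun x => g x p q) μ)
    (A : Mat r n →ₗ[ℝ] Mat r n) : A (entryInt μ g) = entryInt μ fun x => A (g x) := by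
  ext p q
  exact linear_entryInt hg ((Matrix.entryLinearMap ℝ ℝ p q).comp A)

theorem entryInt_mem (hZ : ∀ x ∈ Z, x.IsSymm) {g : Mat r n → Mat r n}
    (hg : ∀ p q, Integrable (fun x => g x p q) μ) (hmem : ∀ᵐ x ∂μ, g x ∈ Z) :
    entryInt μ g ∈ Z := by
  obtain ⟨π, hπ, h⟩ := exists_tip_projection hZ
  have hfix : ∀ x ∈ Z, π x = x := fun x hx => eq_of_tip_eq hZ (hπ x) hx (h x)
  have : π (entryInt μ g) = entryInt μ g := by
    rw [map_entryInt hg]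
    ext p q
    refine integral_congr_ae ?_
    filter_upwards [hmem] with x hx
    rw [hfix _ hx]
  exact this ▸ hπ _

theorem meanMap_eq (θ : Mat r n) :
    meanMap μ θ = (laplaceR μ θ)⁻¹ • entryInt μ fun x => Real.exp (-(tip θ x)) • x := rfl

theorem varOp_eq (θ m ξ : Mat r n) :
    varOp μ θ m ξ = (laplaceR μ θ)⁻¹ •
      entryInt μ fun x => (Real.exp (-(tip θ x)) * tip ξ (x - m)) • (x - m) := rfl

theorem integrable_exp_smul_entry (hZ : ∀ x ∈ Z, x.IsSymm) (hμ : μ (Z : Set (Mat r n))ᶜ = 0)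
    (hC : LineOpen Z C) (hfin : ∀ θ ∈ C, Integrable (fun x => Real.exp (-(tip θ x))) μ)
    {θ : Mat r n} (hθ : θ ∈ C) (p q : Idx r n) :
    Integrable (fun x => (Real.exp (-(tip θ x)) • x) p q) μ := by
  obtain ⟨η, hη, h⟩ := exists_mem_eq_tip hZ (Matrix.entryLinearMap ℝ ℝ p q)
  refine (integrable_exp_mul_tip hC hfin hθ hη).congr ?_
  filter_upwards [ae_mem_of_compl hμ] with x hx
  simp [← h x hx]

theorem integrable_exp_mul_tip_smul_entry (hZ : ∀ x ∈ Z, x.IsSymm)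
    (hμ : μ (Z : Set (Mat r n))ᶜ = 0) (hC : LineOpen Z C)
    (hfin : ∀ θ ∈ C, Integrable (fun x => Real.exp (-(tip θ x))) μ)
    {θ ξ : Mat r n} (hθ : θ ∈ C) (hξ : ξ ∈ Z) (m : Mat r n) (p q : Idx r n) :
    Integrable (fun x => ((Real.exp (-(tip θ x)) * tip ξ (x - m)) • (x - m)) p q) μ := by
  obtain ⟨η, hη, h⟩ := exists_mem_eq_tip hZ (Matrix.entryLinearMap ℝ ℝ p q)
  refine ((((integrable_exp_mul_tip_mul_tip hC hfin hθ hξ hη).sub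
    ((integrable_exp_mul_tip hC hfin hθ hξ).mul_const (m p q))).sub
    ((integrable_exp_mul_tip hC hfin hθ hη).mul_const (tip ξ m))).add
    ((hfin θ hθ).mul_const (tip ξ m * m p q))).congr ?_
  filter_upwards [ae_mem_of_compl hμ] with x hx
  simp only [Pi.add_apply, Pi.sub_apply, ← h x hx, Matrix.smul_apply, Matrix.sub_apply,
    tip_sub_right, smul_eq_mul, Matrix.entryLinearMap_apply]
  ring

theorem meanMap_mem (hZ : ∀ x ∈ Z, x.IsSymm) (hμ : μ (Z : Set (Mat r n))ᶜ = 0)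
    (hC : LineOpen Z C) (hfin : ∀ θ ∈ C, Integrable (fun x => Real.exp (-(tip θ x))) μ)
    {θ : Mat r n} (hθ : θ ∈ C) : meanMap μ θ ∈ Z := by
  rw [meanMap_eq]
  refine Z.smul_mem _ (entryInt_mem hZ (integrable_exp_smul_entry hZ hμ hC hfin hθ) ?_)
  filter_upwards [ae_mem_of_compl hμ] with x hx using Z.smul_mem _ hx

theorem varOp_mem (hZ : ∀ x ∈ Z, x.IsSymm) (hμ : μ (Z : Set (Mat r n))ᶜ = 0)
    (hC : LineOpen Z C) (hfin : ∀ θ ∈ C, Integrable (fun x => Real.exp (-(tip θ x))) μ)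
    {θ m ξ : Mat r n} (hθ : θ ∈ C) (hm : m ∈ Z) (hξ : ξ ∈ Z) : varOp μ θ m ξ ∈ Z := by
  rw [varOp_eq]
  refine Z.smul_mem _
    (entryInt_mem hZ (integrable_exp_mul_tip_smul_entry hZ hμ hC hfin hθ hξ m) ?_)
  filter_upwards [ae_mem_of_compl hμ] with x hx using Z.smul_mem _ (Z.sub_mem hx hm)

theorem laplaceR_pos (hμ0 : μ ≠ 0) {θ : Mat r n}
    (hθ : Integrable (fun x => Real.exp (-(tip θ x))) μ) : 0 < laplaceR μ θ :=
  have : NeZero μ := ⟨hμ0⟩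
  integral_exp_pos hθ

theorem integral_exp_mul_tip_eq (hZ : ∀ x ∈ Z, x.IsSymm) (hμ : μ (Z : Set (Mat r n))ᶜ = 0)
    (hμ0 : μ ≠ 0) (hC : LineOpen Z C)
    (hfin : ∀ θ ∈ C, Integrable (fun x => Real.exp (-(tip θ x))) μ)
    {θ : Mat r n} (hθ : θ ∈ C) (ξ : Mat r n) :
    ∫ x, Real.exp (-(tip θ x)) * tip ξ x ∂μ = laplaceR μ θ * tip ξ (meanMap μ θ) := by
  have := linear_entryInt (integrable_exp_smul_entry hZ hμ hC hfin hθ) (tipₗ ξ)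
  rw [meanMap_eq, ← tipₗ_apply, map_smul, this, smul_eq_mul,
    mul_inv_cancel_left₀ (laplaceR_pos hμ0 (hfin θ hθ)).ne']
  simp

/-- The mean map is injective as soon as its range contains a neighbourhood of `1` in `Z`. -/
theorem meanMap_injOn (hZ : ∀ x ∈ Z, x.IsSymm) (hμ : μ (Z : Set (Mat r n))ᶜ = 0)
    (hμ0 : μ ≠ 0) (hC : LineOpen Z C) (hCZ : C ⊆ Z)
    (hfin : ∀ θ ∈ C, Integrable (fun x => Real.exp (-(tip θ x))) μ)
    {D : Set (Mat r n)} (hD : LineOpen Z D) (h1D : 1 ∈ D)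
    (hsurj : ∀ m ∈ D, ∃ θ ∈ C, meanMap μ θ = m) :
    Set.InjOn (meanMap μ) C := by
  intro θ hθ θ' hθ' heq
  set δ := θ' - θ with hδ
  have hδZ : δ ∈ Z := Z.sub_mem (hCZ hθ') (hCZ hθ)
  set c := tip δ (meanMap μ θ) with hc
  have hzero : ∀ θ₀ ∈ C, tip δ (meanMap μ θ₀) = c →
      Integrable (fun x => Real.exp (-(tip θ₀ x)) * (tip δ x - c)) μ ∧
      ∫ x, Real.exp (-(tip θ₀ x)) * (tip δ x - c) ∂μ = 0 := by
    intro θ₀ h₀ hm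
    have i1 := integrable_exp_mul_tip hC hfin h₀ hδZ
    have i2 := (hfin θ₀ h₀).mul_const c
    have he := integral_exp_mul_tip_eq hZ hμ hμ0 hC hfin h₀ δ
    simp_rw [mul_sub]
    refine ⟨i1.sub i2, ?_⟩
    rw [integral_sub i1 i2, he, integral_mul_const, hm, laplaceR, sub_self]
  obtain ⟨i1, e1⟩ := hzero θ hθ rfl
  obtain ⟨i2, e2⟩ := hzero θ' hθ' (by rw [hc, heq])
  have hae : ∀ᵐ x ∂μ, tip δ x = c := by
    have hexp : ∀ x, Real.exp (-(tip θ' x)) = Real.exp (-(tip θ x)) * Real.exp (-(tip δ x)) := by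
      intro x
      rw [← Real.exp_add, hδ, tip_sub_left]
      ring_nf
    have hsign : ∀ u : ℝ, 0 ≤ u * (1 - Real.exp (-u)) ∧ (u * (1 - Real.exp (-u)) = 0 → u = 0) := by
      intro u
      rcases lt_trichotomy u 0 with h | rfl | h
      · have := Real.one_lt_exp_iff.2 (neg_pos.2 h)
        have := mul_pos_of_neg_of_neg h (sub_neg.2 this)
        exact ⟨this.le, fun h => absurd h this.ne'⟩
      · simp
      · have := Real.exp_lt_one_iff.2 (neg_lt_zero.2 h)
        have := mul_pos h (sub_pos.2 this)
        exact ⟨this.le, fun h => absurd h this.ne'⟩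
    have hform : ∀ x, Real.exp (-(tip θ x)) * (tip δ x - c)
        - Real.exp c * (Real.exp (-(tip θ' x)) * (tip δ x - c))
        = Real.exp (-(tip θ x)) * ((tip δ x - c) * (1 - Real.exp (-(tip δ x - c)))) := by
      intro x
      rw [hexp, neg_sub, sub_eq_add_neg c, Real.exp_add]
      ring
    have hInt := integral_sub i1 (i2.const_mul (Real.exp c))
    have hi : Integrable _ μ := i1.sub (i2.const_mul (Real.exp c))
    rw [integral_const_mul, e1, e2, mul_zero, sub_zero] at hInt
    replace hi := hi.congr (Eventually.of_forall hform)
    simp_rw [hform] at hInt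
    rw [integral_eq_zero_iff_of_nonneg
      (fun x => mul_nonneg (Real.exp_pos _).le (hsign _).1) hi] at hInt
    filter_upwards [hInt] with x hx
    have := (hsign _).2 ((mul_eq_zero.1 hx).resolve_left (Real.exp_pos _).ne')
    linarith
  have hconst : ∀ m ∈ D, tip δ m = c := by
    intro m hm
    obtain ⟨θ₀, h₀, rfl⟩ := hsurj m hm
    have hL := laplaceR_pos hμ0 (hfin θ₀ h₀)
    have he := integral_exp_mul_tip_eq hZ hμ hμ0 hC hfin h₀ δ
    rw [integral_congr_ae (g := fun x => Real.exp (-(tip θ₀ x)) * c)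
      (by filter_upwards [hae] with x hx; rw [hx]), integral_mul_const] at he
    exact (mul_left_cancel₀ hL.ne' he).symm
  have horth : ∀ ξ ∈ Z, tip δ ξ = 0 := by
    intro ξ hξ
    obtain ⟨t, h1, ht⟩ := (((hD 1 h1D ξ hξ).filter_mono nhdsWithin_le_nhds).and
      (self_mem_nhdsWithin (s := Set.Ioi (0 : ℝ)))).exists
    have h2 := hconst _ h1
    rw [tip_comm, tip_add_left, tip_smul_left, tip_comm, hconst _ h1D, tip_comm] at h2
    have h3 : t * tip δ ξ = 0 := by linarith
    exact (mul_eq_zero.1 h3).resolve_left (ne_of_gt ht)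
  have := (tip_self_eq_zero (hZ δ hδZ)).1 (horth δ hδZ)
  exact (sub_eq_zero.1 this).symm

/-- Equivariance of the variance function under a linear map `A` with adjoint `B`, for a measure
that is relatively invariant under `A` in the sense of Laplace transforms near `1`. -/
theorem varOp_equivariant (hZ : ∀ x ∈ Z, x.IsSymm) (h1Z : 1 ∈ Z)
    (hμ : μ (Z : Set (Mat r n))ᶜ = 0) (hμ0 : μ ≠ 0) (hC : LineOpen Z C) (hCZ : C ⊆ Z)
    (h1C : 1 ∈ C) (hfin : ∀ θ ∈ C, laplace μ θ ≠ ∞)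
    {D : Set (Mat r n)} (hD : LineOpen Z D) (h1D : 1 ∈ D)
    {A B : Mat r n →ₗ[ℝ] Mat r n} (hA : ∀ x ∈ Z, A x ∈ Z) (hAinj : ∀ x ∈ Z, A x = 0 → x = 0)
    (hBC : ∀ θ ∈ C, B θ ∈ C) (hBZ : ∀ x ∈ Z, B x ∈ Z) (hAD : A 1 ∈ D)
    (hAB : ∀ x ∈ Z, ∀ y ∈ Z, tip x (A y) = tip (B x) y)
    {k : ℝ} (hk : 0 < k)
    (hL : ∀ ξ ∈ Z, ∀ᶠ t in 𝓝 (0 : ℝ),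
      laplace μ (B (1 + t • ξ)) = ENNReal.ofReal k * laplace μ (1 + t • ξ))
    {ψ : Mat r n → Mat r n} (hψ : ∀ m ∈ D, ψ m ∈ C ∧ meanMap μ (ψ m) = m)
    {ξ : Mat r n} (hξ : ξ ∈ Z) :
    varOp μ (ψ 1) 1 (B ξ) ∈ Z ∧ varOp μ (ψ (A 1)) (A 1) ξ = A (varOp μ (ψ 1) 1 (B ξ)) := by
  have hInt : ∀ θ ∈ C, Integrable (fun x => Real.exp (-(tip θ x))) μ :=
    fun θ hθ => (integrable_exp_iff θ).2 (hfin θ hθ)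
  have hAc : Continuous A := A.continuous_of_finiteDimensional
  have hZm : MeasurableSet (Z : Set (Mat r n))ᶜ :=
    Z.closed_of_finiteDimensional.measurableSet.compl
  have hmapZ : μ.map A (Z : Set (Mat r n))ᶜ = 0 := by
    rw [Measure.map_apply hAc.measurable hZm]
    exact measure_mono_null (fun x hx hxZ => hx (hA x hxZ)) hμ
  have hlap : ∀ ξ ∈ Z, laplace (μ.map A) ξ = laplace μ (B ξ) := by
    intro ξ hξ
    rw [laplace, lintegral_map (by fun_prop) hAc.measurable]
    refine lintegral_congr_ae ?_
    filter_upwards [ae_mem_of_compl hμ] with x hx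
    rw [hAB ξ hξ x hx]
  have hmap : μ.map A = ENNReal.ofReal k • μ := by
    have hlap' : ∀ ξ ∈ Z, ∀ᶠ t in 𝓝 (0 : ℝ), laplace (μ.map A) (1 + t • ξ)
        = ENNReal.ofReal k * laplace μ (1 + t • ξ) := by
      intro ξ hξ
      filter_upwards [hL ξ hξ] with t ht
      rw [hlap _ (Z.add_mem h1Z (Z.smul_mem _ hξ)), ht]
    refine measure_ext_of_laplace hZ hmapZ (by simp [hμ]) (fun ξ hξ => ?_) fun ξ hξ => ?_
    · filter_upwards [hlap' ξ hξ, hC 1 h1C ξ hξ] with t ht hC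
      rw [ht]
      exact ENNReal.mul_ne_top ENNReal.ofReal_ne_top (hfin _ hC)
    · filter_upwards [hlap' ξ hξ] with t ht
      rw [ht, laplace, laplace, lintegral_smul_measure, smul_eq_mul]
  have hchange : ∀ f : Mat r n → ℝ, Continuous f → ∫ x, f (A x) ∂μ = k * ∫ x, f x ∂μ := by
    intro f hf
    rw [← integral_map hAc.aemeasurable (by fun_prop), hmap, integral_smul_measure,
      ENNReal.toReal_ofReal hk.le, smul_eq_mul]
  have hlapR : ∀ θ ∈ Z, laplaceR μ (B θ) = k * laplaceR μ θ := by
    intro θ hθ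
    rw [laplaceR, laplaceR, ← hchange _ (by fun_prop)]
    refine integral_congr_ae ?_
    filter_upwards [ae_mem_of_compl hμ] with x hx
    rw [hAB θ hθ x hx]
  have hmean : ∀ θ ∈ C, A (meanMap μ (B θ)) = meanMap μ θ := by
    intro θ hθ
    rw [meanMap_eq, meanMap_eq, map_smul,
      map_entryInt (integrable_exp_smul_entry hZ hμ hC hInt (hBC θ hθ)), hlapR θ (hCZ hθ)]
    ext p q
    have := hchange (fun x => (Real.exp (-(tip θ x)) • x) p q)
      ((by fun_prop : Continuous fun x => Real.exp (-(tip θ x)) • x).matrix_elem p q)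
    simp only [Matrix.smul_apply, entryInt, Matrix.of_apply, smul_eq_mul] at this ⊢
    rw [_root_.mul_inv_rev, mul_assoc]
    congr 1
    rw [inv_mul_eq_iff_eq_mul₀ hk.ne', ← this]
    refine integral_congr_ae ?_
    filter_upwards [ae_mem_of_compl hμ] with x hx
    simp [hAB θ (hCZ hθ) x hx]
  obtain ⟨h1, hm1⟩ := hψ 1 h1D
  obtain ⟨h2, hm2⟩ := hψ _ hAD
  have hψB : B (ψ (A 1)) = ψ 1 := by
    refine meanMap_injOn hZ hμ hμ0 hC hCZ hInt hD h1D
      (fun m hm => ⟨ψ m, hψ m hm⟩) (hBC _ h2) h1 ?_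
    have hz := Z.sub_mem (meanMap_mem hZ hμ hC hInt (hBC _ h2)) h1Z
    rw [hm1, ← sub_eq_zero]
    refine hAinj _ hz ?_
    rw [map_sub, hmean _ h2, hm2, sub_self]
  refine ⟨varOp_mem hZ hμ hC hInt h1 h1Z (hBZ ξ hξ), ?_⟩
  rw [varOp_eq, varOp_eq, map_smul,
    map_entryInt (integrable_exp_mul_tip_smul_entry hZ hμ hC hInt h1 (hBZ ξ hξ) 1), ← hψB,
    hlapR _ (hCZ h2)]
  ext p q
  have := hchange (fun x => ((Real.exp (-(tip (ψ (A 1)) x)) * tip ξ (x - A 1)) • (x - A 1)) p q)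
    ((by fun_prop : Continuous fun x =>
      (Real.exp (-(tip (ψ (A 1)) x)) * tip ξ (x - A 1)) • (x - A 1)).matrix_elem p q)
  simp only [Matrix.smul_apply, entryInt, Matrix.of_apply, smul_eq_mul] at this ⊢
  rw [_root_.mul_inv_rev, mul_assoc]
  congr 1
  rw [eq_inv_mul_iff_mul_eq₀ hk.ne', ← this]
  refine integral_congr_ae ?_
  filter_upwards [ae_mem_of_compl hμ] with x hx
  rw [← map_sub A, hAB _ (hCZ h2) x hx, hAB ξ hξ _ (Z.sub_mem hx h1Z)]
  simp

end moments

section block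

theorem blk_mul (x y : Mat r n) (l k : Fin (r + 1)) :
    blk (x * y) l k = ∑ j, blk x l j * blk y j k := by
  ext a b
  simp [blk, Matrix.mul_apply, Matrix.sum_apply, Fintype.sum_sigma]

theorem blk_one_self (k : Fin (r + 1)) : blk (1 : Mat r n) k k = 1 := by
  ext a b
  simp [blk, Matrix.one_apply]

theorem blk_one_of_ne {l k : Fin (r + 1)} (h : l ≠ k) : blk (1 : Mat r n) l k = 0 := by
  ext a b
  simp [blk, h]

theorem blk_self_eq_smul_one_iff {x : Mat r n} {k : Fin (r + 1)} {c : ℝ} :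
    blk x k k = c • 1 ↔ ∀ a b : Fin (n k), x ⟨k, a⟩ ⟨k, b⟩ = if a = b then c else 0 := by
  simp [← Matrix.ext_iff, blk, Matrix.one_apply]

theorem tdiag_eq_of_blk {T : Mat r n} {k : Fin (r + 1)} {c : ℝ} (h : blk T k k = c • 1) :
    tdiag T k = c :=
  (blk_self_eq_smul_one_iff.1 h ⟨0, (n k).2⟩ ⟨0, (n k).2⟩).trans (if_pos rfl)

/-- The space `𝒵` as a submodule. -/
def zSubmodule : Submodule ℝ (Mat r n) where
  carrier := Zspace V
  add_mem' := by
    rintro x y ⟨hx, hx', hx''⟩ ⟨hy, hy', hy''⟩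
    refine ⟨hx.add hy, fun k l h => (V l k).add_mem (hx' k l h) (hy' k l h), fun k => ?_⟩
    obtain ⟨c, hc⟩ := hx'' k
    obtain ⟨d, hd⟩ := hy'' k
    refine ⟨c + d, fun a b => ?_⟩
    rw [Matrix.add_apply, hc, hd]
    split_ifs <;> simp
  zero_mem' := ⟨Matrix.transpose_zero, fun k l _ => (V l k).zero_mem, fun k => ⟨0, by simp⟩⟩
  smul_mem' := by
    rintro c x ⟨hx, hx', hx''⟩
    refine ⟨hx.smul c, fun k l h => (V l k).smul_mem c (hx' k l h), fun k => ?_⟩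
    obtain ⟨d, hd⟩ := hx'' k
    refine ⟨c * d, fun a b => ?_⟩
    rw [Matrix.smul_apply, hd]
    split_ifs <;> simp

theorem isSymm_of_mem_zSubmodule (x : Mat r n) (hx : x ∈ zSubmodule V) : x.IsSymm := hx.1

theorem mem_zSubmodule {x : Mat r n} : x ∈ zSubmodule V ↔ x.IsSymm ∧
    (∀ k l, k < l → blk x l k ∈ V l k) ∧ ∀ k, blk x k k ∈ Submodule.span ℝ {1} := by
  simp only [Submodule.mem_span_singleton, eq_comm (b := blk x _ _), blk_self_eq_smul_one_iff]
  exact Iff.rfl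

theorem one_mem_zSubmodule : 1 ∈ zSubmodule V :=
  (mem_zSubmodule V).2 ⟨Matrix.transpose_one, fun k l h => by
    simp [blk_one_of_ne h.ne'], fun k => by
    simp [blk_one_self]⟩

/-- Block lower triangular matrices with strictly lower blocks in `𝒱_{lk}` and scalar diagonal
blocks. -/
def hSubmodule : Submodule ℝ (Mat r n) where
  carrier := {T | (∀ k l, l < k → blk T l k = 0) ∧ (∀ k l, k < l → blk T l k ∈ V l k) ∧
    ∀ k, blk T k k ∈ Submodule.span ℝ {1}}
  add_mem' := fun hx hy =>
    ⟨fun k l h => (congrArg₂ (· + ·) (hx.1 k l h) (hy.1 k l h)).trans (add_zero 0),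
      fun k l h => (V l k).add_mem (hx.2.1 k l h) (hy.2.1 k l h),
      fun k => Submodule.add_mem _ (hx.2.2 k) (hy.2.2 k)⟩
  zero_mem' := ⟨fun _ _ _ => rfl, fun k l _ => (V l k).zero_mem, fun _ => Submodule.zero_mem _⟩
  smul_mem' := fun c _ hx =>
    ⟨fun k l h => (congrArg (c • ·) (hx.1 k l h)).trans (smul_zero c),
      fun k l h => (V l k).smul_mem c (hx.2.1 k l h), fun k => Submodule.smul_mem _ c (hx.2.2 k)⟩

theorem one_mem_hSubmodule : 1 ∈ hSubmodule V :=
  ⟨fun _ _ h => blk_one_of_ne h.ne, fun k l h => by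
    simp [blk_one_of_ne h.ne'], fun k => by
    simp [blk_one_self]⟩

variable {V}

theorem blk_mul_self {A B : Mat r n} (hA : A ∈ hSubmodule V) (hB : B ∈ hSubmodule V)
    (k : Fin (r + 1)) : blk (A * B) k k = blk A k k * blk B k k := by
  rw [blk_mul]
  refine Finset.sum_eq_single k (fun j _ hj => ?_) (by simp)
  rcases lt_or_gt_of_ne hj with h | h
  · rw [hB.1 k j h, Matrix.mul_zero]
  · rw [hA.1 j k h, Matrix.zero_mul]

theorem hSubmodule_mul_mem (hV1 : CondV1 V) {A B : Mat r n} (hA : A ∈ hSubmodule V)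
    (hB : B ∈ hSubmodule V) : A * B ∈ hSubmodule V := by
  refine ⟨fun k l h => ?_, fun k l h => ?_, fun k => ?_⟩
  · rw [blk_mul]
    refine Finset.sum_eq_zero fun j _ => ?_
    rcases lt_or_ge l j with hj | hj
    · rw [hA.1 j l hj, Matrix.zero_mul]
    · rw [hB.1 k j (hj.trans_lt h), Matrix.mul_zero]
  · rw [blk_mul]
    refine Submodule.sum_mem _ fun j _ => ?_
    rcases lt_trichotomy j k with hj | rfl | hj
    · simp [hB.1 k j hj]
    · obtain ⟨c, hc⟩ := Submodule.mem_span_singleton.1 (hB.2.2 j)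
      rw [← hc, Matrix.mul_smul, Matrix.mul_one]
      exact Submodule.smul_mem _ _ (hA.2.1 j l h)
    · rcases lt_trichotomy j l with hj' | rfl | hj'
      · exact hV1 k j l hj hj' _ (hA.2.1 j l hj') _ (hB.2.1 k j hj)
      · obtain ⟨c, hc⟩ := Submodule.mem_span_singleton.1 (hA.2.2 j)
        rw [← hc, Matrix.smul_mul, Matrix.one_mul]
        exact Submodule.smul_mem _ _ (hB.2.1 k j h)
      · simp [hA.1 j l hj']
  · obtain ⟨c, hc⟩ := Submodule.mem_span_singleton.1 (hA.2.2 k)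
    rw [blk_mul_self hA hB, ← hc, Matrix.smul_mul, Matrix.one_mul]
    exact Submodule.smul_mem _ _ (hB.2.2 k)

theorem mul_transpose_self_mem (hV2 : CondV2 V) (hV3 : CondV3 V) {A : Mat r n}
    (hA : A ∈ hSubmodule V) : A * Aᵀ ∈ zSubmodule V := by
  have hblk : ∀ l k, blk (A * Aᵀ) l k = ∑ i, blk A l i * (blk A k i)ᵀ := fun l k => blk_mul _ _ l k
  refine (mem_zSubmodule V).2
    ⟨Matrix.isSymm_mul_transpose_self A, fun k l h => ?_, fun k => ?_⟩
  · rw [hblk]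
    refine Submodule.sum_mem _ fun i _ => ?_
    rcases lt_trichotomy i k with hi | rfl | hi
    · exact hV2 i k l hi h _ (hA.2.1 i l (hi.trans h)) _ (hA.2.1 i k hi)
    · obtain ⟨c, hc⟩ := Submodule.mem_span_singleton.1 (hA.2.2 i)
      rw [← hc, Matrix.transpose_smul, Matrix.transpose_one, Matrix.mul_smul, Matrix.mul_one]
      exact Submodule.smul_mem _ _ (hA.2.1 i l h)
    · simp [hA.1 i k hi]
  · rw [hblk]
    refine Submodule.sum_mem _ fun i _ => Submodule.mem_span_singleton.2 ?_
    rcases lt_trichotomy i k with hi | rfl | hi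
    · obtain ⟨c, hc⟩ := hV3 i k hi _ (hA.2.1 i k hi)
      exact ⟨c, hc.symm⟩
    · obtain ⟨c, hc⟩ := Submodule.mem_span_singleton.1 (hA.2.2 i)
      exact ⟨c * c, by simp [← hc, smul_smul]⟩
    · exact ⟨0, by simp [hA.1 i k hi]⟩

theorem exists_eq_add_transpose {x : Mat r n} (hx : x ∈ zSubmodule V) :
    ∃ A ∈ hSubmodule V, x = A + Aᵀ := by
  obtain ⟨hs, hx', hx''⟩ := (mem_zSubmodule V).1 hx
  refine ⟨Matrix.of fun p q => if q.1 < p.1 then x p q else if q.1 = p.1 then x p q / 2 else 0,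
    ⟨fun k l h => ?_, fun k l h => ?_, fun k => ?_⟩, ?_⟩
  · ext a b
    simp [blk, h.not_gt, h.ne']
  · convert hx' k l h using 1
    ext a b
    simp [blk, h]
  · convert Submodule.smul_mem _ (1 / 2 : ℝ) (hx'' k) using 1
    ext a b
    simp [blk, div_eq_inv_mul]
  · ext p q
    have := hs.apply p q
    rcases lt_trichotomy p.1 q.1 with h | h | h
    · simp [h, h.not_gt, h.ne', this]
    · simp [h, this]
    · simp [h, h.not_gt, h.ne']

theorem rhoM_mem (hV1 : CondV1 V) (hV2 : CondV2 V) (hV3 : CondV3 V) {T x : Mat r n}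
    (hT : T ∈ hSubmodule V) (hx : x ∈ zSubmodule V) : rhoM T x ∈ zSubmodule V := by
  obtain ⟨A, hA, rfl⟩ := exists_eq_add_transpose hx
  have hTA := hSubmodule_mul_mem hV1 hT hA
  have h := Submodule.sub_mem _ (Submodule.sub_mem _
    (mul_transpose_self_mem hV2 hV3 (Submodule.add_mem _ hTA hT))
    (mul_transpose_self_mem hV2 hV3 hTA)) (mul_transpose_self_mem hV2 hV3 hT)
  convert h using 1
  simp only [rhoM, Matrix.transpose_add, Matrix.transpose_mul]
  noncomm_ring

theorem mem_Hgrp_iff {T : Mat r n} :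
    T ∈ Hgrp V ↔ T ∈ hSubmodule V ∧ ∀ k, 0 < tdiag T k := by
  constructor
  · rintro ⟨h1, h2, h3⟩
    refine ⟨⟨h1, h2, fun k => ?_⟩, fun k => ?_⟩
    all_goals obtain ⟨t, ht, h⟩ := h3 k
    · exact Submodule.mem_span_singleton.2 ⟨t, (blk_self_eq_smul_one_iff.2 h).symm⟩
    · rwa [tdiag_eq_of_blk (blk_self_eq_smul_one_iff.2 h)]
  · rintro ⟨⟨h1, h2, h3⟩, h⟩
    refine ⟨h1, h2, fun k => ?_⟩
    obtain ⟨t, ht⟩ := Submodule.mem_span_singleton.1 (h3 k)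
    exact ⟨t, tdiag_eq_of_blk ht.symm ▸ h k, blk_self_eq_smul_one_iff.1 ht.symm⟩

theorem tdiag_one (k : Fin (r + 1)) : tdiag (1 : Mat r n) k = 1 := by simp [tdiag]

theorem one_mem_Hgrp : 1 ∈ Hgrp V :=
  mem_Hgrp_iff.2 ⟨one_mem_hSubmodule V, fun k => by simp [tdiag_one]⟩

theorem tdiag_mul {A B : Mat r n} (hA : A ∈ hSubmodule V) (hB : B ∈ hSubmodule V)
    (k : Fin (r + 1)) : tdiag (A * B) k = tdiag A k * tdiag B k := by
  obtain ⟨c, hc⟩ := Submodule.mem_span_singleton.1 (hA.2.2 k)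
  obtain ⟨d, hd⟩ := Submodule.mem_span_singleton.1 (hB.2.2 k)
  rw [tdiag_eq_of_blk hc.symm, tdiag_eq_of_blk hd.symm]
  refine tdiag_eq_of_blk ?_
  rw [blk_mul_self hA hB, ← hc, ← hd, Matrix.smul_mul, Matrix.one_mul, smul_smul]

theorem Hgrp_mul_mem (hV1 : CondV1 V) {A B : Mat r n} (hA : A ∈ Hgrp V) (hB : B ∈ Hgrp V) :
    A * B ∈ Hgrp V := by
  rw [mem_Hgrp_iff] at *
  refine ⟨hSubmodule_mul_mem hV1 hA.1 hB.1, fun k => ?_⟩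
  rw [tdiag_mul hA.1 hB.1]
  exact mul_pos (hA.2 k) (hB.2 k)

theorem chi_mul (s : Fin (r + 1) → ℝ) {A B : Mat r n} (hA : A ∈ Hgrp V) (hB : B ∈ Hgrp V) :
    chi s (A * B) = chi s A * chi s B := by
  rw [mem_Hgrp_iff] at *
  rw [chi, chi, chi, ← Finset.prod_mul_distrib]
  refine Finset.prod_congr rfl fun k _ => ?_
  rw [tdiag_mul hA.1 hB.1, Real.mul_rpow (hA.2 k).le (hB.2 k).le]

theorem chi_pos (s : Fin (r + 1) → ℝ) {A : Mat r n} (hA : A ∈ Hgrp V) : 0 < chi s A :=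
  Finset.prod_pos fun k _ => Real.rpow_pos_of_pos ((mem_Hgrp_iff.1 hA).2 k) _

theorem chi_one (s : Fin (r + 1) → ℝ) : chi s (1 : Mat r n) = 1 := by simp [chi, tdiag_one]

theorem isUnit_of_mem_Hgrp {T : Mat r n} (hT : T ∈ Hgrp V) : IsUnit T := by
  rw [← Matrix.isUnit_transpose, Matrix.isUnit_iff_isUnit_det, isUnit_iff_ne_zero]
  have htri : Tᵀ.BlockTriangular Sigma.fst := fun p q h =>
    congrFun₂ (hT.1 p.1 q.1 h) q.2 p.2
  rw [htri.det]
  refine Finset.prod_ne_zero_iff.2 fun k _ => ?_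
  obtain ⟨t, ht, h⟩ := hT.2.2 k
  have : Tᵀ.toSquareBlock Sigma.fst k = t • 1 := by
    ext ⟨⟨i, a⟩, rfl⟩ ⟨⟨j, b⟩, hj⟩
    obtain rfl : j = i := hj
    exact (h b a).trans (by simp [Matrix.one_apply, eq_comm])
  rw [this, Matrix.det_smul, Matrix.det_one, mul_one]
  exact pow_ne_zero _ ht.ne'

end block

section orbit

theorem map_nhds_of_bilinear {E F : Type*} [NormedAddCommGroup E] [NormedSpace ℝ E]
    [FiniteDimensional ℝ E] [NormedAddCommGroup F] [NormedSpace ℝ F] [FiniteDimensional ℝ F]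
    (b : E →ₗ[ℝ] E →ₗ[ℝ] F) (e : E) (h : ∀ y, ∃ x, b e x + b x e = y) :
    Filter.map (fun x => b x x) (𝓝 e) = 𝓝 (b e e) := by
  have hd := b.toContinuousBilinearMap.hasStrictFDerivAt_of_bilinear (hasStrictFDerivAt_id e)
    (hasStrictFDerivAt_id e)
  refine hd.map_nhds_eq_of_surj (LinearMap.range_eq_top.2 fun y => ?_)
  obtain ⟨x, hx⟩ := h y
  exact ⟨x, by simpa using hx⟩

open scoped Matrix.Norms.Elementwise in
theorem eventually_exists_Hgrp_of_bilinear (b : Mat r n →ₗ[ℝ] Mat r n →ₗ[ℝ] Mat r n)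
    (hb : ∀ A ∈ hSubmodule V, ∀ B ∈ hSubmodule V, b A B ∈ zSubmodule V) (hb1 : b 1 1 = 1)
    (hsurj : ∀ y ∈ zSubmodule V, ∃ A ∈ hSubmodule V, b 1 A + b A 1 = y)
    {ξ : Mat r n} (hξ : ξ ∈ zSubmodule V) :
    ∀ᶠ t in 𝓝 (0 : ℝ), ∃ A ∈ Hgrp V, 1 + t • ξ = b A A := by
  let b' : hSubmodule V →ₗ[ℝ] hSubmodule V →ₗ[ℝ] zSubmodule V :=
    LinearMap.mk₂ ℝ (fun A B => ⟨b A B, hb A A.2 B B.2⟩) (fun _ _ _ => by ext1; simp)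
      (fun _ _ _ => by ext1; simp) (fun _ _ _ => by ext1; simp) (fun _ _ _ => by ext1; simp)
  let e : hSubmodule V := ⟨1, one_mem_hSubmodule V⟩
  have hmap := map_nhds_of_bilinear b' e fun y => by
    obtain ⟨A, hA, h⟩ := hsurj y y.2
    exact ⟨⟨A, hA⟩, Subtype.ext h⟩
  have hpos : ∀ᶠ A : hSubmodule V in 𝓝 e, ∀ k, 0 < tdiag A.1 k := by
    refine eventually_all.2 fun k => ?_
    have hc : Continuous fun A : hSubmodule V => tdiag A.1 k :=
      continuous_subtype_val.matrix_elem _ _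
    exact hc.continuousAt.eventually (lt_mem_nhds (by simp [e, tdiag_one]))
  have himg := hmap.ge (Filter.image_mem_map hpos)
  let c : ℝ → zSubmodule V := fun t => ⟨1, one_mem_zSubmodule V⟩ + t • ⟨ξ, hξ⟩
  have hc : Continuous c := by fun_prop
  have h0 : c 0 = b' e e := Subtype.ext (by simp [c, b', e, hb1])
  filter_upwards [hc.continuousAt.eventually (h0 ▸ himg)] with t ⟨A, hA, h⟩
  exact ⟨A, mem_Hgrp_iff.2 ⟨A.2, hA⟩, congrArg Subtype.val h.symm⟩

end orbit

section cone

variable {V}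

theorem Pcone_subset : Pcone V ⊆ zSubmodule V := fun _ h => h.1

theorem Qcone_subset : Qcone V ⊆ zSubmodule V := fun _ h => h.1

theorem one_mem_Pcone : 1 ∈ Pcone V := ⟨one_mem_zSubmodule V, Matrix.PosDef.one⟩

theorem eventually_forall_add_mul_pos {X : Type*} [TopologicalSpace X] {K : Set X}
    (hK : IsCompact K) {f g : X → ℝ} (hf : Continuous f) (hg : Continuous g)
    (hpos : ∀ x ∈ K, 0 < f x) : ∀ᶠ t in 𝓝 (0 : ℝ), ∀ x ∈ K, 0 < f x + t * g x := by
  refine hK.eventually_forall_of_forall_eventually fun x hx => ?_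
  have hc : Continuous fun p : ℝ × X => f p.2 + p.1 * g p.2 := by fun_prop
  exact hc.continuousAt.eventually (lt_mem_nhds (by simpa using hpos x hx))

theorem closure_Pcone_subset :
    closure (Pcone V) ⊆ {x | x ∈ zSubmodule V ∧ x.PosSemidef} := by
  refine closure_minimal (fun x hx => ⟨hx.1, hx.2.posSemidef⟩) ?_
  have : {x : Mat r n | x.PosSemidef} =
      {x | x.IsHermitian} ∩ ⋂ v : Idx r n → ℝ, {x | 0 ≤ star v ⬝ᵥ x *ᵥ v} := by
    ext x
    simp [Matrix.posSemidef_iff_dotProduct_mulVec]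
  refine (zSubmodule V).closed_of_finiteDimensional.inter (s₂ := {x | x.PosSemidef}) ?_
  rw [this]
  refine (isClosed_eq (by fun_prop) continuous_id).inter (isClosed_iInter fun v => ?_)
  exact isClosed_le continuous_const (by fun_prop)

theorem one_mem_Qcone : 1 ∈ Qcone V := by
  refine ⟨one_mem_zSubmodule V, fun x hx hx0 => ?_⟩
  have h := (closure_Pcone_subset hx).2
  rw [tip, one_mul]
  exact h.trace_nonneg.lt_of_ne' (h.trace_eq_zero_iff.not.2 hx0)

theorem lineOpen_Pcone : LineOpen (zSubmodule V) (Pcone V) := by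
  intro θ hθ ξ hξ
  have hK := isCompact_sphere (0 : Idx r n → ℝ) 1
  have := eventually_forall_add_mul_pos hK (f := fun v => v ⬝ᵥ θ *ᵥ v)
    (g := fun v => v ⬝ᵥ ξ *ᵥ v) (by fun_prop) (by fun_prop) fun v hv => by
      simpa using hθ.2.dotProduct_mulVec_pos (ne_zero_of_mem_unit_sphere ⟨v, hv⟩)
  filter_upwards [this] with t ht
  have hZ := (zSubmodule V).add_mem hθ.1 ((zSubmodule V).smul_mem t hξ)
  refine ⟨hZ, Matrix.PosDef.of_dotProduct_mulVec_pos
    ((Matrix.conjTranspose_eq_transpose_of_trivial _).trans hZ.1) fun v hv => ?_⟩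
  have hn := inv_pos.2 (norm_pos_iff.2 hv)
  have h := ht (‖v‖⁻¹ • v) (by simp [norm_smul, hv])
  simp only [Matrix.mulVec_smul, smul_dotProduct, dotProduct_smul, smul_eq_mul] at h
  rw [star_trivial, Matrix.add_mulVec, Matrix.smul_mulVec, dotProduct_add, dotProduct_smul,
    smul_eq_mul]
  refine (mul_pos_iff_of_pos_left (mul_pos hn hn)).1 ?_
  linarith

theorem smul_mem_closure_Pcone {c : ℝ} (hc : 0 < c) {x : Mat r n} (hx : x ∈ closure (Pcone V)) :
    c • x ∈ closure (Pcone V) :=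
  map_mem_closure (continuous_const_smul c) hx fun _ hy =>
    ⟨(zSubmodule V).smul_mem c hy.1, hy.2.smul hc⟩

open scoped Matrix.Norms.Elementwise in
theorem lineOpen_Qcone : LineOpen (zSubmodule V) (Qcone V) := by
  intro θ hθ ξ hξ
  have hK : IsCompact (Metric.sphere (0 : Mat r n) 1 ∩ closure (Pcone V)) :=
    (isCompact_sphere _ _).inter_right isClosed_closure
  have := eventually_forall_add_mul_pos hK (continuous_tip θ) (continuous_tip ξ) fun x hx =>
    hθ.2 x hx.2 (ne_zero_of_mem_unit_sphere ⟨x, hx.1⟩)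
  filter_upwards [this] with t ht
  refine ⟨(zSubmodule V).add_mem hθ.1 ((zSubmodule V).smul_mem t hξ), fun x hx hx0 => ?_⟩
  have hn := norm_pos_iff.2 hx0
  have h := ht (‖x‖⁻¹ • x) ⟨by simp [norm_smul, hn.ne'], smul_mem_closure_Pcone (inv_pos.2 hn) hx⟩
  have e : ∀ y : Mat r n, tip y (‖x‖⁻¹ • x) = ‖x‖⁻¹ * tip y x := fun y => (tipₗ y).map_smul _ _
  rw [e, e] at h
  rw [tip_add_left, tip_smul_left]
  refine (mul_pos_iff_of_pos_left (inv_pos.2 hn)).1 ?_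
  linarith

end cone

section action

/-- The action `ρ(T)` as a linear map. -/
def rhoₗ (T : Mat r n) : Mat r n →ₗ[ℝ] Mat r n :=
  (LinearMap.mulRight ℝ Tᵀ).comp (LinearMap.mulLeft ℝ T)

@[simp] theorem rhoₗ_apply (T x : Mat r n) : rhoₗ T x = rhoM T x := rfl

theorem rhoM_mul (T L x : Mat r n) : rhoM (T * L) x = rhoM T (rhoM L x) := by
  simp [rhoM, Matrix.mul_assoc]

theorem rhoM_one_right (T : Mat r n) : rhoM T 1 = T * Tᵀ := by simp [rhoM]

theorem rhoM_one_left (x : Mat r n) : rhoM 1 x = x := by simp [rhoM]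

theorem tip_rhoM (T x y : Mat r n) : tip x (rhoM T y) = tip (rhoM Tᵀ x) y := by
  rw [tip, tip, rhoM, rhoM, ← Matrix.mul_assoc, Matrix.trace_mul_comm]
  simp [Matrix.mul_assoc]

variable {V}

theorem rhoM_eq_zero {T x : Mat r n} (hT : T ∈ Hgrp V) (h : rhoM T x = 0) : x = 0 := by
  have hu := isUnit_of_mem_Hgrp hT
  exact (hu.mul_right_eq_zero).1
    (((Matrix.isUnit_transpose (A := T)).2 hu).mul_left_eq_zero.1 h)

theorem rhoM_mem_Pcone (hV1 : CondV1 V) (hV2 : CondV2 V) (hV3 : CondV3 V) {T x : Mat r n}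
    (hT : T ∈ Hgrp V) (hx : x ∈ Pcone V) : rhoM T x ∈ Pcone V := by
  refine ⟨rhoM_mem hV1 hV2 hV3 (mem_Hgrp_iff.1 hT).1 hx.1, ?_⟩
  have := hx.2.mul_mul_conjTranspose_same
    (Matrix.vecMul_injective_of_isUnit (isUnit_of_mem_Hgrp hT))
  rwa [Matrix.conjTranspose_eq_transpose_of_trivial] at this

theorem rhoM_mem_closure_Pcone (hV1 : CondV1 V) (hV2 : CondV2 V) (hV3 : CondV3 V) {T x : Mat r n}
    (hT : T ∈ Hgrp V) (hx : x ∈ closure (Pcone V)) : rhoM T x ∈ closure (Pcone V) :=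
  map_mem_closure (rhoₗ T).continuous_of_finiteDimensional hx
    fun _ hy => rhoM_mem_Pcone hV1 hV2 hV3 hT hy

theorem eventually_exists_eq_rhoM_one (hV2 : CondV2 V) (hV3 : CondV3 V) {ξ : Mat r n}
    (hξ : ξ ∈ zSubmodule V) :
    ∀ᶠ t in 𝓝 (0 : ℝ), ∃ L ∈ Hgrp V, 1 + t • ξ = rhoM L 1 := by
  obtain ⟨π, hπ, hπ'⟩ := exists_tip_projection (isSymm_of_mem_zSubmodule V)
  have hfix : ∀ x ∈ zSubmodule V, π x = x := fun x hx =>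
    eq_of_tip_eq (isSymm_of_mem_zSubmodule V) (hπ x) hx (hπ' x)
  filter_upwards [eventually_exists_Hgrp_of_bilinear V
    (LinearMap.mk₂ ℝ (fun L M => π (L * Mᵀ)) (by simp [add_mul]) (by simp) (by simp [mul_add])
      (by simp)) (fun _ _ _ _ => hπ _) (by simp [hfix, one_mem_zSubmodule])
    (fun y hy => by
      obtain ⟨A, hA, rfl⟩ := exists_eq_add_transpose hy
      exact ⟨A, hA, by simp [← map_add, add_comm, hfix _ hy]⟩) hξ] with t ⟨L, hL, h⟩
  refine ⟨L, hL, h.trans ?_⟩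
  rw [rhoM_one_right]
  exact hfix _ (mul_transpose_self_mem hV2 hV3 (mem_Hgrp_iff.1 hL).1)

theorem eventually_exists_eq_proj_transpose_mul_self {π : Mat r n →ₗ[ℝ] Mat r n}
    (hπ : ∀ y, π y ∈ zSubmodule V)
    (hπ' : ∀ y, ∀ x ∈ zSubmodule V, tip (π y) x = tip y x)
    {ξ : Mat r n} (hξ : ξ ∈ zSubmodule V) :
    ∀ᶠ t in 𝓝 (0 : ℝ), ∃ L ∈ Hgrp V, 1 + t • ξ = π (rhoM Lᵀ 1) := by
  have hfix : ∀ x ∈ zSubmodule V, π x = x := fun x hx =>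
    eq_of_tip_eq (isSymm_of_mem_zSubmodule V) (hπ x) hx (hπ' x)
  filter_upwards [eventually_exists_Hgrp_of_bilinear V
    (LinearMap.mk₂ ℝ (fun L M => π (Lᵀ * M)) (by simp [add_mul]) (by simp) (by simp [mul_add])
      (by simp)) (fun _ _ _ _ => hπ _) (by simp [hfix, one_mem_zSubmodule])
    (fun y hy => by
      obtain ⟨A, hA, rfl⟩ := exists_eq_add_transpose hy
      exact ⟨A, hA, by simp [← map_add, hfix _ hy]⟩) hξ] with t ⟨L, hL, h⟩
  exact ⟨L, hL, h.trans (by simp [rhoM])⟩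

theorem injective_on_of_adjoint {Z : Submodule ℝ (Mat r n)} (hZ : ∀ x ∈ Z, x.IsSymm)
    {A B : Mat r n →ₗ[ℝ] Mat r n} (hA : ∀ x ∈ Z, A x ∈ Z) (hAinj : ∀ x ∈ Z, A x = 0 → x = 0)
    (hAB : ∀ x ∈ Z, ∀ y ∈ Z, tip x (A y) = tip (B x) y) {x : Mat r n} (hx : x ∈ Z)
    (h : B x = 0) : x = 0 := by
  have hinj : Function.Injective (A.restrict hA) :=
    (injective_iff_map_eq_zero _).2 fun z hz =>
      Subtype.ext (hAinj z z.2 (congrArg Subtype.val hz))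
  obtain ⟨y, hy⟩ := LinearMap.injective_iff_surjective.1 hinj ⟨x, hx⟩
  rw [← tip_self_eq_zero (hZ x hx)]
  have : A y = x := congrArg Subtype.val hy
  nth_rw 2 [← this]
  rw [hAB x hx y y.2, h]
  simp [tip]

end action

end

/-- Let `R*_s` (with `s ∈ 𝔛`, all `s_k > 0`) be the Riesz measure with
Laplace transform `Δ_{-s}` on `𝒫`, and `R_{s'}` (with `s' ∈ Ξ`, all `s'_k > 0`) the Riesz
measure with Laplace transform `δ_{-s'}` on `𝒬`.  Then for every `T ∈ H`, the variance
functions satisfy `V_{F(R*_s)}(ρ*(T) I) = ρ*(T) ∘ V_{F(R*_s)}(I) ∘ ρ(T)` and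
`V_{F(R_{s'})}(ρ(T) I) = ρ(T) ∘ V_{F(R_{s'})}(I) ∘ ρ*(T)` (as operators on `𝒵`). -/
theorem statement10 (r : ℕ) (n : Fin (r + 1) → ℕ+)
    (V : ∀ l k : Fin (r + 1), Submodule ℝ (Matrix (Fin (n l)) (Fin (n k)) ℝ))
    (hV1 : CondV1 V) (hV2 : CondV2 V) (hV3 : CondV3 V)
    (rstar : Mat r n → Mat r n → Mat r n)
    (hrstar : ∀ T ∈ Hgrp V, ∀ ξ ∈ Zspace V, rstar T ξ ∈ Zspace V ∧
      ∀ x ∈ Zspace V, tip (rstar T ξ) x = tip ξ (rhoM T x))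
    (Δf : (Fin (r + 1) → ℝ) → Mat r n → ℝ)
    (hΔ : ∀ s : Fin (r + 1) → ℝ, ∀ T ∈ Hgrp V, Δf s (rhoM T 1) = chi s T)
    (δf : (Fin (r + 1) → ℝ) → Mat r n → ℝ)
    (hδ : ∀ s : Fin (r + 1) → ℝ, ∀ T ∈ Hgrp V, δf s (rstar T 1) = chi s T)
    (s : Fin (r + 1) → ℝ) (hs : s ∈ frakX V) (hspos : ∀ k, 0 < s k)
    (μ : Measure (Mat r n)) (hμsupp : μ (Zspace V)ᶜ = 0)
    (hμL : ∀ θ ∈ Pcone V, laplace μ θ = ENNReal.ofReal (Δf (-s) θ))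
    (ψ : Mat r n → Mat r n)
    (hψ : ∀ m ∈ Qcone V, ψ m ∈ Pcone V ∧ meanMap μ (ψ m) = m)
    (s' : Fin (r + 1) → ℝ) (hs' : s' ∈ XiSet V) (hs'pos : ∀ k, 0 < s' k)
    (μ' : Measure (Mat r n)) (hμ'supp : μ' (Zspace V)ᶜ = 0)
    (hμ'L : ∀ ξ ∈ Qcone V, laplace μ' ξ = ENNReal.ofReal (δf (-s') ξ))
    (ψ' : Mat r n → Mat r n)
    (hψ' : ∀ m ∈ Pcone V, ψ' m ∈ Qcone V ∧ meanMap μ' (ψ' m) = m) :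
    ∀ T ∈ Hgrp V,
      (∀ ξ ∈ Zspace V,
        varOp μ (ψ (rstar T 1)) (rstar T 1) ξ
          = rstar T (varOp μ (ψ 1) 1 (rhoM T ξ))) ∧
      (∀ ξ ∈ Zspace V,
        varOp μ' (ψ' (rhoM T 1)) (rhoM T 1) ξ
          = rhoM T (varOp μ' (ψ' 1) 1 (rstar T ξ))) := by
  intro T hT
  have hsym := isSymm_of_mem_zSubmodule V
  have h1Z := one_mem_zSubmodule V
  obtain ⟨π, hπ, hπ'⟩ := exists_tip_projection hsym
  have hTρ : ∀ x ∈ zSubmodule V, rhoM T x ∈ zSubmodule V := fun x =>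
    rhoM_mem hV1 hV2 hV3 (mem_Hgrp_iff.1 hT).1
  have hadj : ∀ x ∈ zSubmodule V, ∀ y ∈ zSubmodule V,
      tip x (rhoₗ T y) = tip (π.comp (rhoₗ Tᵀ) x) y := fun x _ y hy =>
    (tip_rhoM T x y).trans (hπ' _ y hy).symm
  have hstar : ∀ L ∈ Hgrp V, ∀ ξ ∈ zSubmodule V, rstar L ξ = π (rhoM Lᵀ ξ) := by
    intro L hL ξ hξ
    obtain ⟨hmem, h⟩ := hrstar L hL ξ hξ
    refine eq_of_tip_eq hsym hmem (hπ _) fun z hz => ?_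
    rw [h z hz, hπ' _ z hz, tip_rhoM]
  have hstar_mul : ∀ L ∈ Hgrp V, rstar T (rstar L 1) = rstar (L * T) 1 := by
    intro L hL
    obtain ⟨hmem, h⟩ := hrstar L hL 1 h1Z
    obtain ⟨hmem', h'⟩ := hrstar T hT _ hmem
    obtain ⟨hmem'', h''⟩ := hrstar (L * T) (Hgrp_mul_mem hV1 hL hT) 1 h1Z
    refine eq_of_tip_eq hsym hmem' hmem'' fun z hz => ?_
    rw [h' z hz, h _ (hTρ z hz), h'' z hz, rhoM_mul]
  have hstarQ : ∀ L ∈ Hgrp V, ∀ ξ ∈ Qcone V, rstar L ξ ∈ Qcone V := by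
    intro L hL ξ hξ
    obtain ⟨hmem, h⟩ := hrstar L hL ξ hξ.1
    refine ⟨hmem, fun x hx hx0 => ?_⟩
    rw [h x (closure_Pcone_subset hx).1]
    exact hξ.2 _ (rhoM_mem_closure_Pcone hV1 hV2 hV3 hL hx) fun h0 => hx0 (rhoM_eq_zero hL h0)
  have hρP : ∀ L ∈ Hgrp V, ∀ x ∈ Pcone V, rhoM L x ∈ Pcone V := fun L hL x =>
    rhoM_mem_Pcone hV1 hV2 hV3 hL
  have hstar1 : rstar 1 1 = (1 : Mat r n) := by
    obtain ⟨hmem, h⟩ := hrstar 1 one_mem_Hgrp 1 h1Z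
    exact eq_of_tip_eq hsym hmem h1Z fun z hz => by rw [h z hz, rhoM_one_left]
  have hne : ∀ ν : Measure (Mat r n), laplace ν 1 = 1 → ν ≠ 0 := by
    rintro ν hν rfl
    simp [laplace] at hν
  have hTinj : ∀ x ∈ zSubmodule V, rhoₗ T x = 0 → x = 0 := fun x _ => rhoM_eq_zero hT
  have hμP : ∀ L ∈ Hgrp V, laplace μ (rhoM L 1) = ENNReal.ofReal (chi (-s) L) := fun L hL => by
    rw [hμL _ (hρP L hL _ one_mem_Pcone), hΔ _ L hL]
  have hμQ : ∀ L ∈ Hgrp V, laplace μ' (rstar L 1) = ENNReal.ofReal (chi (-s') L) := fun L hL => by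
    rw [hμ'L _ (hstarQ L hL _ one_mem_Qcone), hδ _ L hL]
  constructor
  · intro ξ hξ
    obtain ⟨hmem, h⟩ := varOp_equivariant (A := π.comp (rhoₗ Tᵀ)) (B := rhoₗ T)
      hsym h1Z hμsupp (hne μ (by simpa [rhoM_one_left, chi_one] using hμP 1 one_mem_Hgrp))
      lineOpen_Pcone Pcone_subset one_mem_Pcone (fun θ hθ => by simp [hμL θ hθ]) lineOpen_Qcone
      one_mem_Qcone (fun x _ => hπ _)
      (fun x hx => injective_on_of_adjoint hsym hTρ hTinj hadj hx) (hρP T hT) hTρ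
      (by simpa [hstar T hT 1 h1Z] using hstarQ T hT 1 one_mem_Qcone)
      (fun x hx y hy => by rw [tip_comm, ← hadj y hy x hx, tip_comm])
      (chi_pos (-s) hT) (fun ζ hζ => by
        filter_upwards [eventually_exists_eq_rhoM_one hV2 hV3 hζ] with t ⟨L, hL, ht⟩
        rw [ht, rhoₗ_apply, ← rhoM_mul, hμP _ (Hgrp_mul_mem hV1 hT hL), hμP L hL,
          chi_mul _ hT hL, ENNReal.ofReal_mul (chi_pos _ hT).le]) hψ hξ
    rw [rhoₗ_apply] at hmem h
    rw [hstar T hT 1 h1Z, hstar T hT _ hmem]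
    exact h
  · intro ξ hξ
    obtain ⟨hmem, h⟩ := varOp_equivariant (A := rhoₗ T) (B := π.comp (rhoₗ Tᵀ))
      hsym h1Z hμ'supp (hne μ' (by simpa [hstar1, chi_one] using hμQ 1 one_mem_Hgrp))
      lineOpen_Qcone Qcone_subset one_mem_Qcone (fun θ hθ => by simp [hμ'L θ hθ]) lineOpen_Pcone
      one_mem_Pcone hTρ hTinj (fun θ hθ => hstar T hT θ hθ.1 ▸ hstarQ T hT θ hθ)
      (fun x _ => hπ _) (hρP T hT 1 one_mem_Pcone) hadj
      (chi_pos (-s') hT) (fun ζ hζ => by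
        filter_upwards [eventually_exists_eq_proj_transpose_mul_self hπ hπ' hζ] with t ⟨L, hL, ht⟩
        rw [← hstar L hL 1 h1Z] at ht
        have hmem := (hrstar L hL 1 h1Z).1
        rw [ht, LinearMap.comp_apply, rhoₗ_apply, ← hstar T hT _ hmem, hstar_mul L hL,
          hμQ _ (Hgrp_mul_mem hV1 hL hT), hμQ L hL, chi_mul _ hL hT, mul_comm,
          ENNReal.ofReal_mul (chi_pos _ hT).le]) hψ' hξ
    rw [hstar T hT ξ hξ]
    exact h

end Wishart
end

section
/- Let T ∈ H and y := T^T T ∈ Sym_+(N,ℝ). Then for every k = 1,…,r−1: T^T J_k* T = y − [ ((y^{−1})_{{1:k}})^{−1} ]_0, where J_k := (I_{N_k})_0 ∈ 𝒵 and J_k* := I_N − J_k. Equivalently, T^T J_k T = [ ((y^{−1})_{{1:k}})^{−1} ]_0. -/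
open Matrix MeasureTheory Finset
open scoped ENNReal

namespace Wishart

variable {r : ℕ} {n : Fin (r + 1) → ℕ+}

variable (V : ∀ l k : Fin (r + 1), Submodule ℝ (Matrix (Fin (n l)) (Fin (n k)) ℝ))

/-- If the blocks of `S` with row index `≤ k` and column index `> k` vanish, then taking leading
submatrices is compatible with left multiplication by `S`. -/
lemma lead_mul {k : Fin (r + 1)} {S : Mat r n}
    (hS : ∀ p q : Idx r n, p.1 ≤ k → k < q.1 → S p q = 0) (X : Mat r n) :
    lead k (S * X) = lead k S * lead k X := by
  ext p q
  simp only [lead, Matrix.of_apply, Matrix.mul_apply]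
  rw [← Finset.sum_subtype (Finset.univ.filter fun m : Idx r n => m.1 ≤ k) (by simp)
    (fun m => S p.1 m * X m q.1), Finset.sum_filter_of_ne]
  intro m _ hm
  contrapose! hm
  rw [hS p.1 m p.2 hm, zero_mul]

lemma lead_transpose (k : Fin (r + 1)) (X : Mat r n) : lead k Xᵀ = (lead k X)ᵀ := rfl

lemma lead_one (k : Fin (r + 1)) : lead k (1 : Mat r n) = 1 := by
  ext p q
  simp [lead, Matrix.one_apply, Subtype.ext_iff]

lemma transpose_mul_Jmat_mul {k : Fin (r + 1)} {T : Mat r n}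
    (hT : ∀ p q : Idx r n, p.1 ≤ k → k < q.1 → T p q = 0) :
    Tᵀ * Jmat k * T = pad k ((lead k T)ᵀ * lead k T) := by
  have hJ : (Jmat k : Mat r n) = Matrix.diagonal fun p => if p.1 ≤ k then 1 else 0 := by
    ext p q
    by_cases hpq : p = q
    · subst hpq
      by_cases hp : p.1 ≤ k <;> simp [Jmat, pad, hp]
    · simp [Jmat, pad, Matrix.one_apply, hpq]
  have hsum (p q : Idx r n) : (Tᵀ * (Jmat k : Mat r n) * T : Mat r n) p q
      = ∑ m : {m : Idx r n // m.1 ≤ k}, T m.1 p * T m.1 q := by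
    rw [hJ, Matrix.mul_apply,
      ← Finset.sum_subtype (Finset.univ.filter fun m : Idx r n => m.1 ≤ k) (by simp)
        (fun m => T m p * T m q), Finset.sum_filter]
    exact Finset.sum_congr rfl fun m _ => by by_cases hm : m.1 ≤ k <;> simp [hm]
  ext p q
  rw [hsum]
  by_cases hpq : p.1 ≤ k ∧ q.1 ≤ k
  · simp [pad, hpq, lead, Matrix.mul_apply]
  · simp only [pad, Matrix.of_apply, dif_neg hpq]
    refine Finset.sum_eq_zero fun m _ => ?_
    rcases not_and_or.mp hpq with h | h
    · rw [hT m.1 p m.2 (not_le.mp h), zero_mul]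
    · rw [hT m.1 q m.2 (not_le.mp h), mul_zero]

variable {V} in
lemma apply_eq_zero_of_mem_Hgrp {T : Mat r n} (hT : T ∈ Hgrp V) {p q : Idx r n}
    (h : p.1 < q.1) : T p q = 0 :=
  congrFun (congrFun (hT.1 q.1 p.1 h) p.2) q.2

variable {V} in
lemma det_ne_zero_of_mem_Hgrp {T : Mat r n} (hT : T ∈ Hgrp V) : T.det ≠ 0 := by
  have htri : Tᵀ.BlockTriangular (Sigma.fst : Idx r n → Fin (r + 1)) :=
    fun p q h => apply_eq_zero_of_mem_Hgrp hT h
  rw [← Matrix.det_transpose, htri.det_fintype]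
  refine Finset.prod_ne_zero_iff.mpr fun k _ => ?_
  obtain ⟨t, ht, htk⟩ := hT.2.2 k
  have hblock : Tᵀ.toSquareBlock Sigma.fst k = Matrix.diagonal fun _ => t := by
    ext ⟨⟨i, a⟩, hi⟩ ⟨⟨j, b⟩, hj⟩
    obtain rfl : i = k := hi
    obtain rfl : j = i := hj
    simp [Matrix.toSquareBlock_def, Matrix.diagonal_apply, htk, eq_comm]
  rw [hblock, Matrix.det_diagonal]
  exact Finset.prod_ne_zero_iff.mpr fun _ _ => ht.ne'

/-- Let `T ∈ H` and `y = Tᵀ T`.  Then for every non-maximal block index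
`k`: `Tᵀ J_k^* T = y - [((y⁻¹)_{1:k})⁻¹]₀` where `J_k = (I_{N_k})₀` and `J_k^* = I - J_k`;
equivalently, `Tᵀ J_k T = [((y⁻¹)_{1:k})⁻¹]₀`. -/
theorem statement11 (r : ℕ) (n : Fin (r + 1) → ℕ+)
    (V : ∀ l k : Fin (r + 1), Submodule ℝ (Matrix (Fin (n l)) (Fin (n k)) ℝ))
    (hV1 : CondV1 V) (hV2 : CondV2 V) (hV3 : CondV3 V) :
    ∀ T ∈ Hgrp V, ∀ k : Fin (r + 1), k ≠ Fin.last r →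
      Tᵀ * ((1 : Mat r n) - Jmat k) * T
          = Tᵀ * T - pad k ((lead k (Tᵀ * T)⁻¹)⁻¹) ∧
      Tᵀ * Jmat k * T = pad k ((lead k (Tᵀ * T)⁻¹)⁻¹) := by
  intro T hT k _
  have htri : ∀ p q : Idx r n, p.1 ≤ k → k < q.1 → T p q = 0 :=
    fun p q hp hq => apply_eq_zero_of_mem_Hgrp hT (hp.trans_lt hq)
  have hdet : IsUnit T.det := isUnit_iff_ne_zero.mpr (det_ne_zero_of_mem_Hgrp hT)
  have hcancel : T * ((Tᵀ * T)⁻¹ * Tᵀ) = 1 := by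
    rw [Matrix.mul_inv_rev, Matrix.mul_assoc, Matrix.nonsing_inv_mul _ (by simpa using hdet),
      Matrix.mul_one, Matrix.mul_nonsing_inv _ hdet]
  have hright : lead k ((Tᵀ * T)⁻¹ * Tᵀ) = lead k (Tᵀ * T)⁻¹ * (lead k T)ᵀ := by
    rw [← Matrix.transpose_transpose ((Tᵀ * T)⁻¹ * Tᵀ), lead_transpose, Matrix.transpose_mul,
      Matrix.transpose_transpose, lead_mul htri, lead_transpose, Matrix.transpose_mul,
      Matrix.transpose_transpose]
  have hinv : (lead k (Tᵀ * T)⁻¹)⁻¹ = (lead k T)ᵀ * lead k T := by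
    refine Matrix.inv_eq_right_inv ?_
    rw [← Matrix.mul_assoc, mul_eq_one_comm, ← hright, ← lead_mul htri, hcancel, lead_one]
  have hJ : Tᵀ * Jmat k * T = pad k ((lead k (Tᵀ * T)⁻¹)⁻¹) := by
    rw [hinv, transpose_mul_Jmat_mul htri]
  exact ⟨by rw [← hJ, Matrix.mul_sub, Matrix.sub_mul, Matrix.mul_one], hJ⟩

end Wishart
end
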